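/- Let k ≥ 1, a ∈ Γ_k, and let u be any nontrivial radial Neumann solution of Δu + a u = 0 on B_1. Then u has a zero in the interval (0, r_k]. Moreover, if u(r_k) = 0 and u has no zero in (0, r_k), then a(r) = μ_k for a.e. r ∈ (0, r_k). -/

import Mathlib

open MeasureTheory Set Filter

noncomputable section

/-- The measure of the (N-1)-dimensional unit sphere in `ℝ^N`. -/
def omegaN (N : ℕ) : ℝ :=
  N * (volume (Metric.ball (0 : EuclideanSpace ℝ (Fin N)) 1)).toReal

/-- `u` is a radial Neumann solution of `Δu + a u = 0` on the unit ball of `ℝ^N`,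
with explicit derivative function `u'` : `u` is continuous on `[0,1]`, differentiable on
`(0,1]`, satisfies the integrated radial equation
`r^(N-1) u'(r) = -∫_0^r s^(N-1) a(s) u(s) ds` on `(0,1]`, and `u'(1) = 0`. -/
def IsRadialNeumannSolutionDeriv (N : ℕ) (a u u' : ℝ → ℝ) : Prop :=
  ContinuousOn u (Icc 0 1) ∧
  (∀ r ∈ Ioc (0:ℝ) 1, HasDerivAt u (u' r) r) ∧
  (∀ r ∈ Ioc (0:ℝ) 1,
    r ^ (N - 1) * u' r = - ∫ s in (0:ℝ)..r, s ^ (N - 1) * a s * u s) ∧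
  u' 1 = 0

/-- `u` is a radial Neumann solution of `Δu + a u = 0` on the unit ball of `ℝ^N`. -/
def IsRadialNeumannSolution (N : ℕ) (a u : ℝ → ℝ) : Prop :=
  ∃ u' : ℝ → ℝ, IsRadialNeumannSolutionDeriv N a u u'

/-- `u` is not identically zero on `[0,1]`. -/
def NontrivialSol (u : ℝ → ℝ) : Prop := ∃ r ∈ Icc (0:ℝ) 1, u r ≠ 0

/-- `μ ≺ a` : `a(r) ≥ μ` for a.e. `r ∈ (0,1)` and `a(r) > μ` on a set of positive measure. -/
def Prec (μ : ℝ) (a : ℝ → ℝ) : Prop :=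
  (∀ᵐ r ∂(volume.restrict (Ioo (0:ℝ) 1)), μ ≤ a r) ∧
  0 < volume {r ∈ Ioo (0:ℝ) 1 | μ < a r}

/-- A radial function `a` belongs to `L^p(B_1)` (finite `p`). -/
def RadialMemLp (N : ℕ) (p : ℝ) (a : ℝ → ℝ) : Prop :=
  IntegrableOn (fun r => r ^ (N - 1) * |a r| ^ p) (Ioo (0:ℝ) 1)

/-- A radial function `a` belongs to `L^∞(B_1)`. -/
def RadialMemLinfty (a : ℝ → ℝ) : Prop :=
  ∃ C : ℝ, ∀ᵐ r ∂(volume.restrict (Ioo (0:ℝ) 1)), |a r| ≤ C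

/-- The `L^p(B_1)` norm of a radial function (finite `p`):
`(ω_N ∫_0^1 r^(N-1) |a(r)|^p dr)^(1/p)`. -/
def radialLpNorm (N : ℕ) (p : ℝ) (a : ℝ → ℝ) : ℝ :=
  (omegaN N * ∫ r in (0:ℝ)..1, r ^ (N - 1) * |a r| ^ p) ^ (1 / p)

/-- The `L^∞(B_1)` norm of a radial function: essential supremum of `|a|` on `(0,1)`. -/
def radialLinftyNorm (a : ℝ → ℝ) : ℝ :=
  essSup (fun r => |a r|) (volume.restrict (Ioo (0:ℝ) 1))

/-- The admissible class `Γ_k` at level `μk`: radial measurable `a` with `μk ≺ a`, such that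
`Δu + a u = 0` has a nontrivial radial Neumann solution, and `a ∈ L^{N/2}(B_1)` if `N ≥ 3`,
or `a ∈ L^q(B_1)` for some `q ∈ (1,∞]` if `N = 2`. -/
def GammaSet (N : ℕ) (μk : ℝ) (a : ℝ → ℝ) : Prop :=
  Measurable a ∧ Prec μk a ∧
  (∃ u : ℝ → ℝ, IsRadialNeumannSolution N a u ∧ NontrivialSol u) ∧
  (if 3 ≤ N then RadialMemLp N ((N : ℝ) / 2) a
   else (∃ q : ℝ, 1 < q ∧ RadialMemLp N q a) ∨ RadialMemLinfty a)

/-- The Lyapunov constant `γ_{p,k}` for finite `p`. -/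
def gammaLyap (N : ℕ) (μk : ℝ) (p : ℝ) : ℝ :=
  sInf {t : ℝ | ∃ a : ℝ → ℝ, GammaSet N μk a ∧ RadialMemLp N p a ∧
    t = radialLpNorm N p (fun r => a r - μk)}

/-- The Lyapunov constant `γ_{∞,k}`. -/
def gammaLyapInfty (N : ℕ) (μk : ℝ) : ℝ :=
  sInf {t : ℝ | ∃ a : ℝ → ℝ, GammaSet N μk a ∧ RadialMemLinfty a ∧
    t = radialLinftyNorm (fun r => a r - μk)}

/-- `(μ, φ)` is the `k`-th radial Neumann eigenpair of `-Δ` on `B_1 ⊆ ℝ^N`: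
`μ ≥ 0`, `φ` is a nontrivial radial Neumann solution of `Δφ + μ φ = 0` having exactly `k`
zeros in `(0,1)`, all simple, given by `rz k < rz (k-1) < ⋯ < rz 1`. -/
def IsRadialNeumannEigenpair (N k : ℕ) (μ : ℝ) (φ : ℝ → ℝ) (rz : ℕ → ℝ) : Prop :=
  0 ≤ μ ∧
  IsRadialNeumannSolution N (fun _ => μ) φ ∧ NontrivialSol φ ∧
  (∀ i, 1 ≤ i → i ≤ k → rz i ∈ Ioo (0:ℝ) 1) ∧
  (∀ i j, 1 ≤ i → i < j → j ≤ k → rz j < rz i) ∧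
  (∀ x ∈ Ioo (0:ℝ) 1, (φ x = 0 ↔ ∃ i, 1 ≤ i ∧ i ≤ k ∧ x = rz i)) ∧
  (∀ i, 1 ≤ i → i ≤ k → ∃ d : ℝ, d ≠ 0 ∧ HasDerivAt φ d (rz i))

/-- `u` (with derivative `u'`) is a radial `H^1` solution of `Δu + a u = 0` in `B_1`:
continuous on `(0,1]`, differentiable on `(0,1)`, satisfying the integrated radial equation
between any two radii, with finite radial `H^1` energy. -/
def IsRadialH1Solution (N : ℕ) (a u u' : ℝ → ℝ) : Prop :=
  ContinuousOn u (Ioc 0 1) ∧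
  (∀ r ∈ Ioo (0:ℝ) 1, HasDerivAt u (u' r) r) ∧
  (∀ s ∈ Ioo (0:ℝ) 1, ∀ r ∈ Ioo (0:ℝ) 1, s < r →
    r ^ (N - 1) * u' r - s ^ (N - 1) * u' s
      = - ∫ t in s..r, t ^ (N - 1) * a t * u t) ∧
  IntegrableOn (fun r => r ^ (N - 1) * ((u' r) ^ 2 + (u r) ^ 2)) (Ioo (0:ℝ) 1)

/-- The Sobolev quotient: infimum of `(∫_{B_ρ} |∇w|²) / (∫_{B_ρ} |w|^q)^{2/q}` over nontrivial
`C^1` functions `w : ℝ^N → ℝ` with compact support contained in the ball `B_ρ`. -/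
def sobolevQuot (N : ℕ) (q : ℝ) (ρ : ℝ) : ℝ :=
  sInf {t : ℝ | ∃ w : EuclideanSpace ℝ (Fin N) → ℝ,
    ContDiff ℝ 1 w ∧ (∃ x, w x ≠ 0) ∧ tsupport w ⊆ Metric.ball 0 ρ ∧
    t = (∫ x in Metric.ball (0 : EuclideanSpace ℝ (Fin N)) ρ, ‖fderiv ℝ w x‖ ^ 2) /
        (∫ x in Metric.ball (0 : EuclideanSpace ℝ (Fin N)) ρ, |w x| ^ q) ^ (2 / q)}

/-- Fundamental theorem of calculus on `[0, R]` for a function that is continuous on `[0, R]` and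
absolutely continuous away from `0`. -/
theorem integral_eq_sub_of_absolutelyContinuous_away {W h : ℝ → ℝ} {R : ℝ} (hR : 0 < R)
    (hW : ContinuousOn W (Icc 0 R)) (hh : IntervalIntegrable h volume 0 R)
    (hac : ∀ ε ∈ Ioo 0 R, AbsolutelyContinuousOnInterval W ε R)
    (hderiv : ∀ᵐ x, x ∈ Ioc 0 R → HasDerivAt W (h x) x) :
    ∫ x in (0:ℝ)..R, h x = W R - W 0 := by
  have hI : uIcc 0 R = Icc 0 R := uIcc_of_le hR.le
  have hprim : ContinuousOn (fun x => ∫ t in (0:ℝ)..x, h t) (Icc 0 R) := by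
    rw [← hI]
    exact intervalIntegral.continuousOn_primitive_interval' hh left_mem_uIcc
  have hlim : ∀ {g : ℝ → ℝ}, ContinuousOn g (Icc 0 R) →
      Tendsto g (nhdsWithin 0 (Ioo 0 R)) (nhds (g 0)) := fun hg =>
    (hg 0 (left_mem_Icc.2 hR.le)).mono_left (nhdsWithin_mono _ Ioo_subset_Icc_self)
  have hne : (nhdsWithin (0:ℝ) (Ioo 0 R)).NeBot := left_nhdsWithin_Ioo_neBot hR
  have hsum := (hlim hprim).sub (hlim hW)
  have hconst : (fun ε => (∫ t in (0:ℝ)..ε, h t) - W ε) =ᶠ[nhdsWithin 0 (Ioo 0 R)]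
      fun _ => (∫ t in (0:ℝ)..R, h t) - W R := by
    filter_upwards [self_mem_nhdsWithin] with ε hε
    have hsub : ∫ x in ε..R, h x = W R - W ε := by
      rw [← (hac ε hε).integral_deriv_eq_sub]
      refine intervalIntegral.integral_congr_ae ?_
      filter_upwards [hderiv] with x hx hxI
      rw [uIoc_of_le hε.2.le] at hxI
      exact (hx ⟨hε.1.trans hxI.1, hxI.2⟩).deriv.symm
    have hadd := intervalIntegral.integral_add_adjacent_intervals
      (hh.mono_set (c := 0) (d := ε)
        (by rw [hI, uIcc_of_le hε.1.le]; exact Icc_subset_Icc_right hε.2.le))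
      (hh.mono_set (c := ε) (d := R)
        (by rw [hI, uIcc_of_le hε.2.le]; exact Icc_subset_Icc_left hε.1.le))
    linarith
  have := tendsto_nhds_unique hsum (tendsto_const_nhds.congr' hconst.symm)
  simp only [intervalIntegral.integral_same] at this
  linarith

namespace IsRadialNeumannSolutionDeriv

variable {N : ℕ} {a u u' : ℝ → ℝ}

theorem intervalIntegrable_weight_mul (hu : IsRadialNeumannSolutionDeriv N a u u')
    (ha : IntervalIntegrable (fun s => s ^ (N - 1) * a s) volume 0 1) :
    IntervalIntegrable (fun s => s ^ (N - 1) * a s * u s) volume 0 1 :=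
  ha.mul_continuousOn (by rw [uIcc_of_le zero_le_one]; exact hu.1)

theorem continuousOn_primitive (hu : IsRadialNeumannSolutionDeriv N a u u')
    (ha : IntervalIntegrable (fun s => s ^ (N - 1) * a s) volume 0 1) :
    ContinuousOn (fun r => ∫ s in (0:ℝ)..r, s ^ (N - 1) * a s * u s) (Icc 0 1) := by
  have h := intervalIntegral.continuousOn_primitive_interval'
    (hu.intervalIntegrable_weight_mul ha) left_mem_uIcc
  rwa [uIcc_of_le zero_le_one] at h

theorem deriv_eq (hu : IsRadialNeumannSolutionDeriv N a u u') {r : ℝ} (hr : r ∈ Ioc (0:ℝ) 1) :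
    u' r = -(r ^ (N - 1))⁻¹ * ∫ s in (0:ℝ)..r, s ^ (N - 1) * a s * u s := by
  have h := hu.2.2.1 r hr
  have hpos : r ^ (N - 1) ≠ 0 := (pow_pos hr.1 _).ne'
  rw [neg_mul, ← mul_neg, ← h]
  field_simp

theorem absolutelyContinuousOnInterval (hu : IsRadialNeumannSolutionDeriv N a u u')
    (ha : IntervalIntegrable (fun s => s ^ (N - 1) * a s) volume 0 1) {ε R : ℝ}
    (hε : 0 < ε) (hεR : ε ≤ R) (hR : R ≤ 1) : AbsolutelyContinuousOnInterval u ε R := by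
  have hsub : Icc ε R ⊆ Ioc 0 1 := fun x hx => ⟨hε.trans_le hx.1, hx.2.trans hR⟩
  have hcont : ContinuousOn u' (Icc ε R) := by
    refine ContinuousOn.congr (ContinuousOn.mul ?_
      ((hu.continuousOn_primitive ha).mono (hsub.trans Ioc_subset_Icc_self)))
      fun r hr => hu.deriv_eq (hsub hr)
    exact ((continuousOn_id.pow _).inv₀ fun x hx => (pow_pos (hsub hx).1 _).ne').neg
  obtain ⟨C, hC⟩ := isCompact_Icc.exists_bound_of_continuousOn hcont
  refine LipschitzOnWith.absolutelyContinuousOnInterval (K := C.toNNReal) ?_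
  rw [uIcc_of_le hεR]
  refine (convex_Icc ε R).lipschitzOnWith_of_nnnorm_hasDerivWithin_le
    (fun x hx => (hu.2.1 x (hsub hx)).hasDerivWithinAt) fun x hx => ?_
  rw [← NNReal.coe_le_coe, coe_nnnorm]
  exact (hC x hx).trans (Real.le_coe_toNNReal C)

/-- Lagrange identity for two radial solutions with different potentials. -/
theorem wronskian_eq_integral (hu : IsRadialNeumannSolutionDeriv N a u u')
    (ha : IntervalIntegrable (fun s => s ^ (N - 1) * a s) volume 0 1) {b v v' : ℝ → ℝ}
    (hv : IsRadialNeumannSolutionDeriv N b v v')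
    (hb : IntervalIntegrable (fun s => s ^ (N - 1) * b s) volume 0 1)
    {R : ℝ} (hR : R ∈ Ioc (0:ℝ) 1) :
    IntervalIntegrable (fun s => s ^ (N - 1) * (a s - b s) * (u s * v s)) volume 0 R ∧
    ∫ s in (0:ℝ)..R, s ^ (N - 1) * (a s - b s) * (u s * v s) =
      R ^ (N - 1) * (u R * v' R - v R * u' R) := by
  have hsub : Icc 0 R ⊆ Icc (0:ℝ) 1 := Icc_subset_Icc_right hR.2
  have hR0 : uIcc 0 R = Icc 0 R := uIcc_of_le hR.1.le
  have hh : IntervalIntegrable (fun s => s ^ (N - 1) * (a s - b s) * (u s * v s)) volume 0 R := by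
    simp only [mul_sub]
    exact ((ha.sub hb).mono_set (by rwa [hR0, uIcc_of_le zero_le_one])).mul_continuousOn
      (by rw [hR0]; exact (hu.1.mono hsub).mul (hv.1.mono hsub))
  refine ⟨hh, ?_⟩
  have hiu := hu.intervalIntegrable_weight_mul ha
  have hiv := hv.intervalIntegrable_weight_mul hb
  have hkey := integral_eq_sub_of_absolutelyContinuous_away
    (W := fun r => v r * (∫ s in (0:ℝ)..r, s ^ (N - 1) * a s * u s) -
      u r * ∫ s in (0:ℝ)..r, s ^ (N - 1) * b s * v s) hR.1 ?_ hh ?_ ?_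
  · rw [hkey]
    simp only [intervalIntegral.integral_same]
    linear_combination v R * hu.2.2.1 R hR - u R * hv.2.2.1 R hR
  · exact ((hv.1.mul (hu.continuousOn_primitive ha)).sub
      (hu.1.mul (hv.continuousOn_primitive hb))).mono hsub
  · intro ε hε
    have hp : ∀ {g : ℝ → ℝ}, IntervalIntegrable g volume 0 1 →
        AbsolutelyContinuousOnInterval (fun x => ∫ s in (0:ℝ)..x, g s) ε R := fun hg =>
      (hg.absolutelyContinuousOnInterval_intervalIntegral left_mem_uIcc).mono (by
        rw [uIcc_of_le hε.2.le, uIcc_of_le zero_le_one]; exact Icc_subset_Icc hε.1.le hR.2)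
    exact ((hv.absolutelyContinuousOnInterval hb hε.1 hε.2.le hR.2).fun_mul (hp hiu)).sub
      ((hu.absolutelyContinuousOnInterval ha hε.1 hε.2.le hR.2).fun_mul (hp hiv))
  · filter_upwards [hiu.ae_hasDerivAt_integral, hiv.ae_hasDerivAt_integral] with x hxu hxv hx
    have hx1 : x ∈ Ioc (0:ℝ) 1 := ⟨hx.1, hx.2.trans hR.2⟩
    have hxI : x ∈ uIcc (0:ℝ) 1 := by
      rw [uIcc_of_le zero_le_one]; exact Ioc_subset_Icc_self hx1
    convert! ((hv.2.1 x hx1).mul (hxu hxI 0 left_mem_uIcc)).sub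
      ((hu.2.1 x hx1).mul (hxv hxI 0 left_mem_uIcc)) using 1
    rw [hu.deriv_eq hx1, hv.deriv_eq hx1]
    ring

/-- The negative of a radial solution is a radial solution. -/
theorem neg (hu : IsRadialNeumannSolutionDeriv N a u u') :
    IsRadialNeumannSolutionDeriv N a (fun r => -u r) (fun r => -u' r) := by
  refine ⟨hu.1.neg, fun r hr => (hu.2.1 r hr).neg, fun r hr => ?_, by simp [hu.2.2.2]⟩
  simp only [mul_neg, intervalIntegral.integral_neg]
  rw [hu.2.2.1 r hr]

end IsRadialNeumannSolutionDeriv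

theorem RadialMemLp.intervalIntegrable {N : ℕ} {p : ℝ} {a : ℝ → ℝ} (hp : 1 ≤ p)
    (ham : Measurable a) (ha : RadialMemLp N p a) :
    IntervalIntegrable (fun s => s ^ (N - 1) * a s) volume 0 1 := by
  rw [intervalIntegrable_iff_integrableOn_Ioo_of_le zero_le_one]
  have h1 : IntegrableOn (fun s : ℝ => s ^ (N - 1)) (Ioo 0 1) :=
    ((continuous_pow _).integrableOn_Icc (a := 0) (b := 1)).mono_set Ioo_subset_Icc_self
  refine Integrable.mono' (h1.add ha) (by fun_prop) ?_
  filter_upwards [ae_restrict_mem measurableSet_Ioo] with s hs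
  have hs0 : 0 ≤ s ^ (N - 1) := pow_nonneg hs.1.le _
  have habs : |a s| ≤ 1 + |a s| ^ p := by
    rcases le_total |a s| 1 with h | h
    · linarith [Real.rpow_nonneg (abs_nonneg (a s)) p]
    · linarith [Real.self_le_rpow_of_one_le h hp]
  rw [norm_mul, Real.norm_of_nonneg hs0, Real.norm_eq_abs, Pi.add_apply]
  linarith [mul_le_mul_of_nonneg_left habs hs0]

theorem RadialMemLinfty.intervalIntegrable {a : ℝ → ℝ} (N : ℕ)
    (ham : Measurable a) (ha : RadialMemLinfty a) :
    IntervalIntegrable (fun s => s ^ (N - 1) * a s) volume 0 1 := by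
  obtain ⟨C, hC⟩ := ha
  rw [intervalIntegrable_iff_integrableOn_Ioo_of_le zero_le_one]
  have h1 : IntegrableOn (fun s : ℝ => s ^ (N - 1) * C) (Ioo 0 1) :=
    ((by fun_prop : Continuous fun s : ℝ => s ^ (N - 1) * C).integrableOn_Icc
      (a := 0) (b := 1)).mono_set Ioo_subset_Icc_self
  refine Integrable.mono' h1 (by fun_prop) ?_
  filter_upwards [ae_restrict_mem measurableSet_Ioo, hC] with s hs hCs
  have hs0 : 0 ≤ s ^ (N - 1) := pow_nonneg hs.1.le _
  rw [norm_mul, Real.norm_of_nonneg hs0, Real.norm_eq_abs]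
  exact mul_le_mul_of_nonneg_left hCs hs0

theorem GammaSet.intervalIntegrable {N : ℕ} {μ : ℝ} {a : ℝ → ℝ} (ha : GammaSet N μ a) :
    IntervalIntegrable (fun s => s ^ (N - 1) * a s) volume 0 1 := by
  obtain ⟨ham, -, -, hmem⟩ := ha
  split_ifs at hmem with hN
  · have hN' : (3:ℝ) ≤ N := by exact_mod_cast hN
    exact hmem.intervalIntegrable (by linarith) ham
  · rcases hmem with ⟨q, hq, hmem⟩ | hmem
    · exact hmem.intervalIntegrable hq.le ham
    · exact hmem.intervalIntegrable N ham

/-- A continuous function without zeros on a preconnected set has a sign there. -/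
theorem forall_pos_or_forall_neg_of_ne_zero {f : ℝ → ℝ} {s : Set ℝ} (hs : IsPreconnected s)
    (hf : ContinuousOn f s) (hne : ∀ x ∈ s, f x ≠ 0) :
    (∀ x ∈ s, 0 < f x) ∨ ∀ x ∈ s, f x < 0 := by
  by_contra! h
  obtain ⟨⟨x, hx, hfx⟩, y, hy, hfy⟩ := h
  obtain ⟨z, hz, hfz⟩ := hs.intermediate_value hx hy hf ⟨hfx, hfy⟩
  exact hne z hz hfz

/-- A function that is positive on `(0, R)` and vanishes at `R` has nonpositive derivative
at `R`. -/
theorem HasDerivAt.nonpos_of_pos_left {f : ℝ → ℝ} {d R : ℝ} (hR : 0 < R) (hf : HasDerivAt f d R)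
    (hzero : f R = 0) (hpos : ∀ x ∈ Ioo 0 R, 0 < f x) : d ≤ 0 := by
  have hne : (nhdsWithin R (Ioo 0 R)).NeBot := right_nhdsWithin_Ioo_neBot hR
  have h := (hasDerivAt_iff_tendsto_slope.1 hf).mono_left
    (nhdsWithin_mono R fun x (hx : x ∈ Ioo 0 R) => hx.2.ne)
  refine le_of_tendsto h ?_
  filter_upwards [self_mem_nhdsWithin] with x hx
  rw [slope_def_field, hzero, sub_zero]
  exact div_nonpos_of_nonneg_of_nonpos (hpos x hx).le (by linarith [hx.2])

/-- Sturm comparison up to the first zero of the reference solution `v`, for positive solutions. -/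
theorem sturm_comparison_of_pos {N : ℕ} {a b u u' v v' : ℝ → ℝ} {R : ℝ}
    (hu : IsRadialNeumannSolutionDeriv N a u u')
    (ha : IntervalIntegrable (fun s => s ^ (N - 1) * a s) volume 0 1)
    (hv : IsRadialNeumannSolutionDeriv N b v v')
    (hb : IntervalIntegrable (fun s => s ^ (N - 1) * b s) volume 0 1)
    (hR : R ∈ Ioc (0:ℝ) 1)
    (hab : ∀ᵐ r ∂(volume.restrict (Ioo (0:ℝ) 1)), b r ≤ a r)
    (hvR : v R = 0) (hv'R : v' R ≠ 0) (hvpos : ∀ r ∈ Ioo 0 R, 0 < v r)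
    (hupos : ∀ r ∈ Ioo 0 R, 0 < u r) :
    u R ≤ 0 ∧ (u R = 0 → ∀ᵐ r ∂(volume.restrict (Ioo (0:ℝ) R)), a r = b r) := by
  obtain ⟨hint, hW⟩ := hu.wronskian_eq_integral ha hv hb hR
  have hv'neg : v' R < 0 :=
    lt_of_le_of_ne ((hv.2.1 R hR).nonpos_of_pos_left hR.1 hvR hvpos) hv'R
  have hpow : 0 < R ^ (N - 1) := pow_pos hR.1 _
  have hnonneg : 0 ≤ᵐ[volume.restrict (Ioo 0 R)]
      fun s => s ^ (N - 1) * (a s - b s) * (u s * v s) := by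
    filter_upwards [ae_restrict_mem measurableSet_Ioo,
      ae_restrict_of_ae_restrict_of_subset (Ioo_subset_Ioo_right hR.2) hab] with s hs hs'
    exact mul_nonneg (mul_nonneg (pow_nonneg hs.1.le _) (sub_nonneg.2 hs'))
      (mul_pos (hupos s hs) (hvpos s hs)).le
  rw [intervalIntegral.integral_of_le hR.1.le, integral_Ioc_eq_integral_Ioo, hvR, zero_mul,
    sub_zero] at hW
  refine ⟨?_, fun huR => ?_⟩
  · have h0 := integral_nonneg_of_ae hnonneg
    rw [hW] at h0
    by_contra! hcon
    exact absurd h0 (not_le.2 (mul_neg_of_pos_of_neg hpow (mul_neg_of_pos_of_neg hcon hv'neg)))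
  · rw [huR, zero_mul, mul_zero, setIntegral_eq_zero_iff_of_nonneg_ae hnonneg
      ((intervalIntegrable_iff_integrableOn_Ioo_of_le hR.1.le).1 hint)] at hW
    filter_upwards [ae_restrict_mem measurableSet_Ioo, hW] with s hs hs'
    have h1 : s ^ (N - 1) ≠ 0 := (pow_pos hs.1 _).ne'
    have h2 : u s * v s ≠ 0 := (mul_pos (hupos s hs) (hvpos s hs)).ne'
    have h3 : a s - b s = 0 := by simpa [h1, h2, (hupos s hs).ne', (hvpos s hs).ne'] using hs'
    linarith

/-- Sturm comparison up to the first zero of the reference solution `v`. -/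
theorem sturm_comparison {N : ℕ} {a b u u' v v' : ℝ → ℝ} {R : ℝ}
    (hu : IsRadialNeumannSolutionDeriv N a u u')
    (ha : IntervalIntegrable (fun s => s ^ (N - 1) * a s) volume 0 1)
    (hv : IsRadialNeumannSolutionDeriv N b v v')
    (hb : IntervalIntegrable (fun s => s ^ (N - 1) * b s) volume 0 1)
    (hR : R ∈ Ioc (0:ℝ) 1)
    (hab : ∀ᵐ r ∂(volume.restrict (Ioo (0:ℝ) 1)), b r ≤ a r)
    (hvR : v R = 0) (hv'R : v' R ≠ 0) (hvne : ∀ r ∈ Ioo 0 R, v r ≠ 0) :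
    (∃ z ∈ Ioc 0 R, u z = 0) ∧
    (u R = 0 → (∀ z ∈ Ioo 0 R, u z ≠ 0) →
      ∀ᵐ r ∂(volume.restrict (Ioo (0:ℝ) R)), a r = b r) := by
  have hsub : Ioo 0 R ⊆ Icc (0:ℝ) 1 := fun x hx => ⟨hx.1.le, hx.2.le.trans hR.2⟩
  wlog hvpos : ∀ r ∈ Ioo 0 R, 0 < v r generalizing v v'
  · have hvneg := (forall_pos_or_forall_neg_of_ne_zero isPreconnected_Ioo (hv.1.mono hsub)
      hvne).resolve_left hvpos
    exact this hv.neg (by simpa using hvR) (by simpa using hv'R) (by simpa using hvne)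
      fun r hr => neg_pos.2 (hvneg r hr)
  refine ⟨?_, fun huR hune => ?_⟩
  · by_contra! hcon
    have hsub' : Ioc 0 R ⊆ Icc (0:ℝ) 1 := fun x hx => ⟨hx.1.le, hx.2.trans hR.2⟩
    have hRmem : R ∈ Ioc 0 R := ⟨hR.1, le_rfl⟩
    rcases forall_pos_or_forall_neg_of_ne_zero isPreconnected_Ioc (hu.1.mono hsub') hcon
      with hpos | hneg
    · exact absurd (sturm_comparison_of_pos hu ha hv hb hR hab hvR hv'R hvpos
        fun r hr => hpos r (Ioo_subset_Ioc_self hr)).1 (not_le.2 (hpos R hRmem))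
    · exact absurd (sturm_comparison_of_pos hu.neg ha hv hb hR hab hvR hv'R hvpos
        fun r hr => neg_pos.2 (hneg r (Ioo_subset_Ioc_self hr))).1
        (not_le.2 (neg_pos.2 (hneg R hRmem)))
  · rcases forall_pos_or_forall_neg_of_ne_zero isPreconnected_Ioo (hu.1.mono hsub) hune
      with hpos | hneg
    · exact (sturm_comparison_of_pos hu ha hv hb hR hab hvR hv'R hvpos hpos).2 huR
    · exact (sturm_comparison_of_pos hu.neg ha hv hb hR hab hvR hv'R hvpos
        fun r hr => neg_pos.2 (hneg r hr)).2 (by simpa using huR)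

/-- For `k ≥ 1`, `a ∈ Γ_k`, any nontrivial radial Neumann solution `u` of
`Δu + a u = 0` vanishes somewhere in `(0, r_k]`; moreover if `u(r_k) = 0` is its only zero
there, then `a ≡ μ_k` a.e. on `(0, r_k)`. -/
theorem stmt5 (N k : ℕ) (hN : 2 ≤ N) (hk1 : 1 ≤ k) (μk : ℝ) (φk : ℝ → ℝ) (rz : ℕ → ℝ)
    (hek : IsRadialNeumannEigenpair N k μk φk rz)
    (a : ℝ → ℝ) (ha : GammaSet N μk a)
    (u : ℝ → ℝ) (hu : IsRadialNeumannSolution N a u) (hunt : NontrivialSol u) :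
    (∃ z ∈ Ioc (0:ℝ) (rz k), u z = 0) ∧
    (u (rz k) = 0 → (∀ z ∈ Ioo (0:ℝ) (rz k), u z ≠ 0) →
      ∀ᵐ r ∂(volume.restrict (Ioo (0:ℝ) (rz k))), a r = μk) := by
  obtain ⟨u', hu⟩ := hu
  obtain ⟨-, ⟨φ', hφ⟩, -, hrz, hanti, hzeros, hsimple⟩ := hek
  have hRk := hrz k hk1 le_rfl
  have hR : rz k ∈ Ioc (0:ℝ) 1 := Ioo_subset_Ioc_self hRk
  obtain ⟨d, hd, hφd⟩ := hsimple k hk1 le_rfl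
  have hb : IntervalIntegrable (fun s : ℝ => s ^ (N - 1) * μk) volume 0 1 :=
    (by fun_prop : Continuous fun s : ℝ => s ^ (N - 1) * μk).intervalIntegrable 0 1
  refine sturm_comparison hu ha.intervalIntegrable hφ hb hR ha.2.1.1
    ((hzeros _ hRk).2 ⟨k, hk1, le_rfl, rfl⟩) ?_ fun r hr hφr => ?_
  · rwa [(hφ.2.1 _ hR).unique hφd]
  · obtain ⟨i, hi1, hik, rfl⟩ := (hzeros r ⟨hr.1, hr.2.trans hRk.2⟩).1 hφr
    rcases hik.eq_or_lt with rfl | hlt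
    · exact lt_irrefl _ hr.2
    · exact lt_asymm hr.2 (hanti i k hi1 hlt le_rfl)
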